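/- arXiv:1112.3238 — 2 statements merged into one kernel-verified Lean document; each statement's English description precedes it below -/
import Mathlib

section
/- Let n ≥ 3 be odd and let s : Fin n → (Fin 2 → Fin 2) be a local deterministic strategy. Then: (a) there is at most one bit string x : Fin n → Fin 2 with x_1 ⊕ ⋯ ⊕ x_n = 0 and x_{i+1} = s_i(x_i) for all i (indices cyclic); and (b) such an x exists — i.e. s saturates GYNI_n — if and only if either (i) some component s_k is a constant function, and the evaluation s' of s satisfies s'_1 ⊕ ⋯ ⊕ s'_n = 0, or (ii) every component s_k is the identity or the flip on Fin 2, and the number of components equal to the flip is even. -/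
noncomputable section

/-- Cyclic successor on `Fin n`. -/
def cnext {n : ℕ} (i : Fin n) : Fin n := ⟨((i : ℕ) + 1) % n, Nat.mod_lt _ i.pos⟩

/-- The box of a local deterministic strategy `s`, as a vector indexed by pairs
`(a, x)` of output and input bit strings: `P_s(a|x) = ∏_i [a_i = s_i(x_i)]`. -/
def stratBox {n : ℕ} (s : Fin n → Fin 2 → Fin 2) :
    (Fin n → Fin 2) × (Fin n → Fin 2) → ℝ :=
  fun ax => ∏ i, if ax.1 i = s i (ax.2 i) then 1 else 0

/-- Even parity of a bit string: `x₁ ⊕ ⋯ ⊕ x_n = 0`. -/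
def parity0 {n : ℕ} (x : Fin n → Fin 2) : Prop := (∑ i, (x i : ℕ)) % 2 = 0

/-- A strategy `s` saturates the GYNI_n inequality (for odd `n`) iff there is a bit string
`x` of even parity with `x_{i+1} = s_i(x_i)` for all `i` (indices cyclic). -/
def Saturates {n : ℕ} (s : Fin n → Fin 2 → Fin 2) : Prop :=
  ∃ x : Fin n → Fin 2, parity0 x ∧ ∀ i, x (cnext i) = s i (x i)

/-- The constant strategy associated to a bit string `c`. -/
def constStrat {n : ℕ} (c : Fin n → Fin 2) : Fin n → Fin 2 → Fin 2 := fun j _ => c j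

/-- The flip (negation) function on bits. -/
def flip2 : Fin 2 → Fin 2 := ![1, 0]

/-- A property of cyclic indices that holds somewhere and is preserved by `cnext` holds
everywhere. -/
theorem cnext_induction {n : ℕ} {p : Fin n → Prop} (k : Fin n) (hk : p k)
    (hs : ∀ i, p i → p (cnext i)) (j : Fin n) : p j := by
  have iter : ∀ m : ℕ, p ⟨((k : ℕ) + m) % n, Nat.mod_lt _ k.pos⟩ := by
    intro m
    induction m with
    | zero => simpa [Nat.mod_eq_of_lt k.isLt] using hk
    | succ m ih =>
      have h := hs _ ih
      simpa [cnext, Nat.add_assoc] using h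
  have h := iter (n - k + j)
  have e : ((k : ℕ) + (n - k + j)) % n = j := by
    rw [show (k : ℕ) + (n - k + j) = j + n by omega, Nat.add_mod_right,
      Nat.mod_eq_of_lt j.isLt]
  simpa only [e] using h

theorem cnext_injective {n : ℕ} : Function.Injective (cnext : Fin n → Fin n) := by
  intro i j h
  have h' : ((i : ℕ) + 1) % n = ((j : ℕ) + 1) % n := congrArg Fin.val h
  have h'' : (i : ℕ) ≡ j [MOD n] := Nat.ModEq.add_right_cancel' 1 h'
  exact Fin.ext (Nat.ModEq.eq_of_lt_of_lt h'' i.isLt j.isLt)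

theorem sum_comp_cnext {n : ℕ} (f : Fin n → ℕ) : ∑ i, f (cnext i) = ∑ i, f i :=
  (Finite.injective_iff_bijective.mp cnext_injective).sum_comp f

/-- Complementing every bit of a string of odd length changes its parity. -/
theorem parity0_complement_iff {n : ℕ} (hodd : Odd n) {x y : Fin n → Fin 2}
    (h : ∀ i, x i ≠ y i) : parity0 x ↔ ¬ parity0 y := by
  have e : ∑ i, (x i : ℕ) + ∑ i, (y i : ℕ) = n := by
    rw [← Finset.sum_add_distrib, Finset.sum_congr rfl (g := fun _ => 1)]
    · simp
    · intro i _
      have := h i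
      omega
  obtain ⟨m, hm⟩ := hodd
  unfold parity0
  omega

theorem eq_id_or_flip2_or_const (f : Fin 2 → Fin 2) :
    (f = id ∨ f = flip2) ∨ ∀ b₁ b₂, f b₁ = f b₂ := by
  revert f
  decide

theorem val_apply_of_id_or_flip2 {f : Fin 2 → Fin 2} (hf : f = id ∨ f = flip2) (b : Fin 2) :
    (f b : ℕ) = ((b : ℕ) + f 0) % 2 := by
  rcases hf with rfl | rfl <;> revert b <;> decide

theorem card_flips {n : ℕ} {s : Fin n → Fin 2 → Fin 2} (hs : ∀ k, s k = id ∨ s k = flip2) :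
    (Finset.univ.filter (fun k => s k = flip2)).card = ∑ k, (s k 0 : ℕ) := by
  rw [Finset.card_filter]
  refine Finset.sum_congr rfl fun k _ => ?_
  rcases hs k with h | h <;> rw [h] <;> decide

/-- A cyclically consistent bit string forces an even number of flips. -/
theorem even_sum_of_consistent {n : ℕ} {s : Fin n → Fin 2 → Fin 2}
    (hs : ∀ k, s k = id ∨ s k = flip2) {x : Fin n → Fin 2}
    (hx : ∀ i, x (cnext i) = s i (x i)) : Even (∑ k, (s k 0 : ℕ)) := by
  have h1 : ∑ i, (x i : ℕ) = ∑ i, ((x i : ℕ) + s i 0) % 2 := by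
    rw [← sum_comp_cnext (fun i => (x i : ℕ))]
    refine Finset.sum_congr rfl fun i _ => ?_
    rw [hx i, val_apply_of_id_or_flip2 (hs i)]
  have h2 := Finset.sum_nat_mod Finset.univ 2 (fun i => (x i : ℕ) + s i 0)
  rw [← h1, Finset.sum_add_distrib] at h2
  rw [Nat.even_iff]
  omega

/-- An even number of flips admits a cyclically consistent bit string. -/
theorem exists_consistent_of_even_sum {n : ℕ} {s : Fin n → Fin 2 → Fin 2}
    (hs : ∀ k, s k = id ∨ s k = flip2) (he : Even (∑ k, (s k 0 : ℕ))) :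
    ∃ x : Fin n → Fin 2, ∀ i, x (cnext i) = s i (x i) := by
  let c : ℕ → ℕ := fun j => if h : j < n then (s ⟨j, h⟩ 0 : ℕ) else 0
  have hc : ∀ i : Fin n, c i = s i 0 := fun i => by simp [c]
  let f : ℕ → ℕ := fun k => ∑ j ∈ Finset.range k, c j
  have hf : f n % 2 = 0 := by
    have : f n = ∑ k, (s k 0 : ℕ) := by
      simp only [f, Finset.sum_range, hc]
    rw [this]
    exact Nat.even_iff.mp he
  have hmod : ∀ i : Fin n, f (((i : ℕ) + 1) % n) % 2 = f ((i : ℕ) + 1) % 2 := by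
    intro i
    rcases Nat.lt_or_ge ((i : ℕ) + 1) n with h | h
    · rw [Nat.mod_eq_of_lt h]
    · have e : (i : ℕ) + 1 = n := by omega
      rw [e, Nat.mod_self, hf]
      simp [f]
  refine ⟨fun i => ⟨f i % 2, Nat.mod_lt _ two_pos⟩, fun i => Fin.ext ?_⟩
  rw [val_apply_of_id_or_flip2 (hs i)]
  change f (((i : ℕ) + 1) % n) % 2 = (f i % 2 + s i 0) % 2
  rw [hmod, ← hc i]
  simp only [f, Finset.sum_range_succ, Nat.mod_add_mod]

/-- For odd `n ≥ 3` and any strategy `s`: (a) there is at most one even-parity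
bit string `x` with `x_{i+1} = s_i(x_i)` for all `i`; (b) `s` saturates GYNI_n iff either
some component of `s` is constant and the evaluation of `s` (the unique cyclically
consistent bit string) has even parity, or every component of `s` is the identity or the
flip and the number of flips is even. -/
theorem stmt16 {n : ℕ} (hn : 3 ≤ n) (hodd : Odd n) (s : Fin n → Fin 2 → Fin 2) :
    (∀ x y : Fin n → Fin 2,
      (parity0 x ∧ ∀ i, x (cnext i) = s i (x i)) →
      (parity0 y ∧ ∀ i, y (cnext i) = s i (y i)) → x = y) ∧
    (Saturates s ↔
      ((∃ k, ∀ b₁ b₂ : Fin 2, s k b₁ = s k b₂) ∧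
        ∃ s' : Fin n → Fin 2, (∀ i, s' (cnext i) = s i (s' i)) ∧ parity0 s') ∨
      ((∀ k, s k = id ∨ s k = flip2) ∧
        Even (Finset.univ.filter (fun k => s k = flip2)).card)) := by
  refine ⟨?_, ?_, ?_⟩
  · rintro x y ⟨hx, hxs⟩ ⟨hy, hys⟩
    by_cases h : ∃ k, x k = y k
    · obtain ⟨k, hk⟩ := h
      refine funext (cnext_induction k hk fun i hi => ?_)
      rw [hxs, hys, hi]
    · push Not at h
      exact absurd hy ((parity0_complement_iff hodd h).mp hx)
  · rintro ⟨x, hx, hxs⟩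
    by_cases h : ∃ k, ∀ b₁ b₂ : Fin 2, s k b₁ = s k b₂
    · exact Or.inl ⟨h, x, hxs, hx⟩
    · have hs : ∀ k, s k = id ∨ s k = flip2 := fun k =>
        (eq_id_or_flip2_or_const (s k)).resolve_right fun hk => h ⟨k, hk⟩
      exact Or.inr ⟨hs, card_flips hs ▸ even_sum_of_consistent hs hxs⟩
  · rintro (⟨-, x, hxs, hx⟩ | ⟨hs, he⟩)
    · exact ⟨x, hx, hxs⟩
    · rw [card_flips hs] at he
      obtain ⟨x, hxs⟩ := exists_consistent_of_even_sum hs he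
      by_cases hx : parity0 x
      · exact ⟨x, hx, hxs⟩
      · have hne : ∀ b : Fin 2, flip2 b ≠ b := by decide
        refine ⟨fun i => flip2 (x i),
          (parity0_complement_iff hodd fun i => hne (x i)).mpr hx, fun i => ?_⟩
        rcases hs i with h | h <;> simp only [hxs, h, id]
end
end

section
/- Let n ≥ 3 be odd and let a, b, d be natural numbers with a + b + d = n and b odd. Let w be the bit string consisting of a zeros, followed by b ones, followed by d zeros, and let 1ⁿ be the all-ones bit string. Then P_{[w]} − P_{[1ⁿ]} lies in the real linear span of { P_u : u a strategy saturating GYNI_n }. -/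
noncomputable section

/-- Cyclic predecessor on `Fin n`. -/
def cprev {n : ℕ} (i : Fin n) : Fin n := ⟨((i : ℕ) + (n - 1)) % n, Nat.mod_lt _ i.pos⟩

lemma cnext_cprev {n : ℕ} (i : Fin n) : cnext (cprev i) = i := by
  ext
  have := i.isLt
  simp only [cnext, cprev, Nat.mod_add_mod]
  rw [show (i : ℕ) + (n - 1) + 1 = i + n by omega, Nat.add_mod_right, Nat.mod_eq_of_lt i.isLt]

lemma cprev_cnext {n : ℕ} (i : Fin n) : cprev (cnext i) = i := by
  ext
  have := i.isLt
  simp only [cnext, cprev, Nat.mod_add_mod]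
  rw [show (i : ℕ) + 1 + (n - 1) = i + n by omega, Nat.add_mod_right, Nat.mod_eq_of_lt i.isLt]

lemma cprev_bijective {n : ℕ} : Function.Bijective (cprev : Fin n → Fin n) :=
  Function.bijective_iff_has_inverse.mpr ⟨cnext, cnext_cprev, cprev_cnext⟩

lemma cnext_ne {n : ℕ} (hn : 2 ≤ n) (i : Fin n) : cnext i ≠ i := by
  intro h
  have h' := congrArg Fin.val h
  have := i.isLt
  simp only [cnext] at h'
  rcases Nat.lt_or_ge ((i : ℕ) + 1) n with hlt | hge
  · rw [Nat.mod_eq_of_lt hlt] at h'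
    omega
  · rw [show (i : ℕ) + 1 = n by omega, Nat.mod_self] at h'
    omega

lemma cnext_iterate_val {n : ℕ} (i : Fin n) (m : ℕ) :
    ((cnext^[m] i : Fin n) : ℕ) = (i + m) % n := by
  induction m with
  | zero => simp [Nat.mod_eq_of_lt i.isLt]
  | succ m ih =>
    rw [Function.iterate_succ_apply']
    simp [cnext, ih, add_assoc]

/-- A set of sites that is nonempty and misses a site has an element whose successor
is missed. -/
lemma exists_mem_cnext_notMem {n : ℕ} {R : Finset (Fin n)} (hR : R.Nonempty) {k : Fin n}
    (hk : k ∉ R) : ∃ i ∈ R, cnext i ∉ R := by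
  by_contra! h
  obtain ⟨i, hi⟩ := hR
  have hiter : ∀ m, cnext^[m] i ∈ R := fun m => by
    induction m with
    | zero => exact hi
    | succ m ih => rw [Function.iterate_succ_apply']; exact h _ ih
  refine hk ?_
  convert hiter (n - i + k)
  ext
  have := i.isLt
  rw [cnext_iterate_val, show (i : ℕ) + (n - i + k) = k + n by omega, Nat.add_mod_right,
    Nat.mod_eq_of_lt k.isLt]

lemma stratBox_update {n : ℕ} (s : Fin n → Fin 2 → Fin 2) (i : Fin n) (f : Fin 2 → Fin 2)
    (ax : (Fin n → Fin 2) × (Fin n → Fin 2)) :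
    stratBox (Function.update s i f) ax =
      (if ax.1 i = f (ax.2 i) then 1 else 0) *
        ∏ j ∈ Finset.univ.erase i, if ax.1 j = s j (ax.2 j) then 1 else 0 := by
  rw [stratBox, ← Finset.mul_prod_erase _ _ (Finset.mem_univ i), Function.update_self]
  congr 1
  refine Finset.prod_congr rfl fun j hj => ?_
  rw [Function.update_of_ne (Finset.ne_of_mem_erase hj)]

/-- At a single site, the two constant functions and the two permutations have the same
total box. -/
lemma stratBox_const_add_const {n : ℕ} (s : Fin n → Fin 2 → Fin 2) (i : Fin n) (c d : Fin 2) :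
    stratBox (Function.update s i fun _ => c) + stratBox (Function.update s i fun _ => c + 1) =
      stratBox (Function.update s i fun z => z + d) +
        stratBox (Function.update s i fun z => z + d + 1) := by
  funext ax
  simp only [Pi.add_apply, stratBox_update, ← add_mul]
  congr 1
  generalize ax.1 i = y
  generalize ax.2 i = z
  fin_cases c <;> fin_cases d <;> fin_cases y <;> fin_cases z <;> simp

lemma val_add_one_add_val (z : Fin 2) : ((z + 1 : Fin 2) : ℕ) + (z : ℕ) = 1 := by
  fin_cases z <;> rfl

lemma parity0_update_add_one {n : ℕ} {x : Fin n → Fin 2} (hx : ¬ parity0 x) (j : Fin n) :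
    parity0 (Function.update x j (x j + 1)) := by
  unfold parity0 at *
  rw [← Finset.add_sum_erase _ _ (Finset.mem_univ j)] at hx ⊢
  have hsum : ∑ i ∈ Finset.univ.erase j, (Function.update x j (x j + 1) i : ℕ) =
      ∑ i ∈ Finset.univ.erase j, (x i : ℕ) :=
    Finset.sum_congr rfl fun i hi => by
      rw [Function.update_of_ne (Finset.ne_of_mem_erase hi)]
  rw [hsum, Function.update_self]
  have := val_add_one_add_val (x j)
  omega

lemma parity0_add_one {n : ℕ} (hodd : Odd n) {x : Fin n → Fin 2} (hx : ¬ parity0 x) :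
    parity0 fun i => x i + 1 := by
  simp only [parity0] at *
  have h : ∑ i, ((x i + 1 : Fin 2) : ℕ) + ∑ i, (x i : ℕ) = n := by
    rw [← Finset.sum_add_distrib]
    simp [val_add_one_add_val]
  obtain ⟨m, hm⟩ := hodd
  omega

/-- The span of the boxes of the saturating strategies. -/
def saturatingSpan (n : ℕ) : Submodule ℝ ((Fin n → Fin 2) × (Fin n → Fin 2) → ℝ) :=
  Submodule.span ℝ {v | ∃ u : Fin n → Fin 2 → Fin 2, Saturates u ∧ v = stratBox u}

lemma stratBox_mem_saturatingSpan {n : ℕ} {s : Fin n → Fin 2 → Fin 2} (hs : Saturates s) :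
    stratBox s ∈ saturatingSpan n :=
  Submodule.subset_span ⟨s, hs, rfl⟩

/-- The strategy following the cycle `x` by a permutation at the sites of `R` and by a
constant elsewhere. -/
def followStrat {n : ℕ} (x : Fin n → Fin 2) (R : Finset (Fin n)) : Fin n → Fin 2 → Fin 2 :=
  fun i z => if i ∈ R then z + (x i + x (cnext i)) else x (cnext i)

lemma add_add_self_left (p q : Fin 2) : p + (p + q) = q := by
  revert p q; decide

lemma add_one_add_add_self_left (p q : Fin 2) : p + 1 + (p + q) = q + 1 := by
  revert p q; decide

lemma followStrat_apply {n : ℕ} (x : Fin n → Fin 2) (R : Finset (Fin n)) (i : Fin n) :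
    followStrat x R i (x i) = x (cnext i) := by
  unfold followStrat
  split_ifs
  · exact add_add_self_left _ _
  · rfl

lemma update_followStrat_const {n : ℕ} (x : Fin n → Fin 2) {R : Finset (Fin n)} {i : Fin n}
    (hi : i ∉ R) : Function.update (followStrat x R) i (fun _ => x (cnext i)) =
      followStrat x R := by
  rw [Function.update_eq_self_iff]
  funext z
  simp [followStrat, hi]

lemma update_followStrat_perm {n : ℕ} (x : Fin n → Fin 2) (R : Finset (Fin n)) (i : Fin n) :
    Function.update (followStrat x R) i (fun z => z + (x i + x (cnext i))) =
      followStrat x (insert i R) := by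
  funext j z
  rcases eq_or_ne j i with rfl | hj
  · simp [followStrat]
  · simp [followStrat, hj]

/-- Replacing a constant by the matching permutation just before another constant does not
change the box of an odd cycle modulo the saturating boxes. -/
lemma stratBox_followStrat_sub_insert_mem {n : ℕ} (hn : 2 ≤ n) {x : Fin n → Fin 2}
    (hx : ¬ parity0 x) {R : Finset (Fin n)} {i : Fin n} (hi : i ∉ R) (hi' : cnext i ∉ R) :
    stratBox (followStrat x R) - stratBox (followStrat x (insert i R)) ∈ saturatingSpan n := by
  have hrel := stratBox_const_add_const (followStrat x R) i (x (cnext i)) (x i + x (cnext i))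
  rw [update_followStrat_const x hi, update_followStrat_perm] at hrel
  rw [sub_eq_sub_iff_add_eq_add.mpr (hrel.trans (add_comm _ _))]
  have hsat : ∀ f : Fin 2 → Fin 2, f (x i) = x (cnext i) + 1 →
      Saturates (Function.update (followStrat x R) i f) := by
    intro f hf
    refine ⟨Function.update x (cnext i) (x (cnext i) + 1), parity0_update_add_one hx _,
      fun j => ?_⟩
    rcases eq_or_ne j i with rfl | hj
    · rw [Function.update_self, Function.update_self,
        Function.update_of_ne (cnext_ne hn j).symm, hf]
    · have hj' : cnext j ≠ cnext i := fun h =>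
        hj (by rw [← cprev_cnext j, h, cprev_cnext])
      rw [Function.update_of_ne hj', Function.update_of_ne hj]
      rcases eq_or_ne j (cnext i) with rfl | hji
      · simp [followStrat, hi']
      · rw [Function.update_of_ne hji, followStrat_apply]
  refine Submodule.sub_mem _ (stratBox_mem_saturatingSpan (hsat _ ?_))
    (stratBox_mem_saturatingSpan (hsat _ rfl))
  rw [add_add_self_left]

lemma stratBox_followStrat_empty_sub_mem {n : ℕ} (hn : 2 ≤ n) {x : Fin n → Fin 2}
    (hx : ¬ parity0 x) {k : Fin n} (R : Finset (Fin n)) (hk : k ∉ R) :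
    stratBox (followStrat x ∅) - stratBox (followStrat x R) ∈ saturatingSpan n := by
  induction R using Finset.strongInduction with
  | H R ih =>
    rcases R.eq_empty_or_nonempty with rfl | hR
    · simp
    obtain ⟨i, hi, hi'⟩ := exists_mem_cnext_notMem hR hk
    have h₁ := ih (R.erase i) (Finset.erase_ssubset hi) fun h => hk (Finset.mem_of_mem_erase h)
    have h₂ := stratBox_followStrat_sub_insert_mem hn hx (Finset.notMem_erase i R)
      fun h => hi' (Finset.mem_of_mem_erase h)
    rw [Finset.insert_erase hi] at h₂
    simpa using add_mem h₁ h₂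

/-- The strategy applying the permutation `z ↦ z + p i` at each site `i`. -/
def shiftStrat {n : ℕ} (p : Fin n → Fin 2) : Fin n → Fin 2 → Fin 2 := fun i z => z + p i

/-- Modulo the saturating boxes, the constant strategy of an odd string equals the
permutation strategy following it at every site but one. -/
lemma stratBox_constStrat_sub_shiftStrat_mem {n : ℕ} (hn : 2 ≤ n) (hodd : Odd n)
    {x : Fin n → Fin 2} (hx : ¬ parity0 x) (k : Fin n) :
    stratBox (constStrat fun i => x (cnext i)) -
      stratBox (shiftStrat fun i => x i + x (cnext i) + if i = k then 1 else 0) ∈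
        saturatingSpan n := by
  set R : Finset (Fin n) := Finset.univ.erase k with hR
  have hk : k ∉ R := Finset.notMem_erase _ _
  have h₁ := stratBox_followStrat_empty_sub_mem hn hx R hk
  have hconst : followStrat x ∅ = constStrat fun i => x (cnext i) := by
    funext i z
    simp [followStrat, constStrat]
  have hshift : Function.update (followStrat x R) k (fun z => z + (x k + x (cnext k)) + 1) =
      shiftStrat fun i => x i + x (cnext i) + if i = k then 1 else 0 := by
    funext j z
    rcases eq_or_ne j k with rfl | hj
    · simp [shiftStrat, add_assoc]
    · simp [followStrat, shiftStrat, hR, hj]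
  have hrel := stratBox_const_add_const (followStrat x R) k (x (cnext k)) (x k + x (cnext k))
  rw [update_followStrat_const x hk, hshift] at hrel
  have hsat : ∀ f : Fin 2 → Fin 2, f (x k + 1) = x (cnext k) + 1 →
      Saturates (Function.update (followStrat x R) k f) := by
    intro f hf
    refine ⟨fun i => x i + 1, parity0_add_one hodd hx, fun j => ?_⟩
    rcases eq_or_ne j k with rfl | hj
    · rw [Function.update_self, hf]
    · rw [Function.update_of_ne hj]
      simp [followStrat, hR, hj, add_one_add_add_self_left]
  have h₂ := Submodule.sub_mem _
    (stratBox_mem_saturatingSpan (hsat (fun z => z + (x k + x (cnext k)))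
      (add_one_add_add_self_left _ _)))
    (stratBox_mem_saturatingSpan (hsat (fun _ => x (cnext k) + 1) rfl))
  rw [← sub_eq_sub_iff_add_eq_add.mpr hrel] at h₂
  rw [hconst] at h₁
  simpa using add_mem h₁ h₂

/-- The odd constant strategies of `c` and `c'` are equal modulo the saturating boxes when
their cyclic differences agree after toggling one site of each. -/
lemma stratBox_constStrat_sub_constStrat_mem {n : ℕ} (hn : 2 ≤ n) (hodd : Odd n)
    {c c' : Fin n → Fin 2} (hc : ¬ parity0 c) (hc' : ¬ parity0 c') (k l : Fin n)
    (h : ∀ i, c (cprev i) + c i + (if i = k then 1 else 0) =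
      c' (cprev i) + c' i + (if i = l then 1 else 0)) :
    stratBox (constStrat c) - stratBox (constStrat c') ∈ saturatingSpan n := by
  have hpar : ∀ {y : Fin n → Fin 2}, ¬ parity0 y → ¬ parity0 fun i => y (cprev i) := by
    intro y hy
    unfold parity0 at *
    rwa [cprev_bijective.sum_comp fun i => (y i : ℕ)]
  have h₁ := stratBox_constStrat_sub_shiftStrat_mem hn hodd (hpar hc) k
  have h₂ := stratBox_constStrat_sub_shiftStrat_mem hn hodd (hpar hc') l
  simp only [cprev_cnext, h] at h₁ h₂
  simpa using sub_mem h₁ h₂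

lemma sum_interval {n a b d : ℕ} (habd : a + b + d = n) :
    ∑ i : Fin n, ((if a ≤ (i : ℕ) ∧ (i : ℕ) < a + b then 1 else 0 : Fin 2) : ℕ) = b := by
  have h : ∀ i : Fin n, ((if a ≤ (i : ℕ) ∧ (i : ℕ) < a + b then 1 else 0 : Fin 2) : ℕ) =
      if a ≤ (i : ℕ) ∧ (i : ℕ) < a + b then 1 else 0 := fun i => by split_ifs <;> rfl
  simp only [h]
  rw [Fin.sum_univ_eq_sum_range (fun i => if a ≤ i ∧ i < a + b then 1 else 0) n,
    ← Finset.card_filter]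
  have : (Finset.range n).filter (fun i => a ≤ i ∧ i < a + b) = Finset.Ico a (a + b) := by
    ext i
    simp only [Finset.mem_filter, Finset.mem_range, Finset.mem_Ico]
    omega
  simp [this]

/-- For odd `n ≥ 3` and `a + b + d = n` with `b` odd, the difference
`P_{[w]} − P_{[1ⁿ]}` lies in the real linear span of the boxes of the saturating
strategies, where `w` consists of `a` zeros, then `b` ones, then `d` zeros, and `1ⁿ` is
the all-ones string. -/
theorem stmt19 {n : ℕ} (hn : 3 ≤ n) (hodd : Odd n)
    (a b d : ℕ) (habd : a + b + d = n) (hb : Odd b) :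
    stratBox (constStrat
        (fun i : Fin n => if a ≤ (i : ℕ) ∧ (i : ℕ) < a + b then 1 else 0)) -
      stratBox (constStrat (fun _ : Fin n => 1)) ∈
      Submodule.span ℝ
        {v | ∃ u : Fin n → Fin 2 → Fin 2, Saturates u ∧ v = stratBox u} := by
  obtain ⟨m, hm⟩ := hb
  have hw : ¬ parity0 (fun i : Fin n => if a ≤ (i : ℕ) ∧ (i : ℕ) < a + b then 1 else 0) := by
    rw [parity0, sum_interval habd]
    omega
  have h1 : ¬ parity0 (fun _ : Fin n => 1) := by
    obtain ⟨r, hr⟩ := hodd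
    simp only [parity0, Fin.val_one, Finset.sum_const, Finset.card_univ, Fintype.card_fin,
      smul_eq_mul, mul_one]
    omega
  refine stratBox_constStrat_sub_constStrat_mem (by omega) hodd hw h1 ⟨a, by omega⟩
    ⟨(a + b) % n, Nat.mod_lt _ (by omega)⟩ fun i => ?_
  have hi := i.isLt
  have hprev : ((cprev i : Fin n) : ℕ) = if (i : ℕ) = 0 then n - 1 else i - 1 := by
    simp only [cprev]
    split_ifs with h0
    · rw [h0, zero_add, Nat.mod_eq_of_lt (by omega)]
    · rw [show (i : ℕ) + (n - 1) = (i - 1) + n by omega, Nat.add_mod_right,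
        Nat.mod_eq_of_lt (by omega)]
  have hmod : (a + b) % n = if d = 0 then 0 else a + b := by
    split_ifs with h0
    · rw [show a + b = n by omega, Nat.mod_self]
    · exact Nat.mod_eq_of_lt (by omega)
  simp only [Fin.ext_iff, hprev, hmod]
  split_ifs <;> first | rfl | omega
end
end
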